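/- Let V be a real vector space of dimension 2n and let E be a complex subspace of the complexification V_ℂ with dim_ℂ E = n and E ∩ Ē = {0}. Then there exists a unique ℝ-linear map K : V → V such that K ∘ K = −id_V and E = {v + i·Kv : v ∈ V}. -/

import Mathlib

open TensorProduct

/-- The complex conjugation on the complexification `ℂ ⊗[ℝ] V` of a real vector space `V`,
sending `v + i·w` to `v - i·w` (i.e. `z ⊗ v ↦ z̄ ⊗ v`), as an `ℝ`-linear map. -/
noncomputable def complexificationConj (V : Type*) [AddCommGroup V] [Module ℝ V] :
    (ℂ ⊗[ℝ] V) →ₗ[ℝ] (ℂ ⊗[ℝ] V) :=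
  LinearMap.rTensor V (Complex.conjAe.toLinearMap : ℂ →ₗ[ℝ] ℂ)

/-- The real part `v + i·w ↦ v` on the complexification. -/
noncomputable def complexificationRe (V : Type*) [AddCommGroup V] [Module ℝ V] :
    (ℂ ⊗[ℝ] V) →ₗ[ℝ] V :=
  (TensorProduct.lid ℝ V).toLinearMap ∘ₗ LinearMap.rTensor V Complex.reLm

/-- The imaginary part `v + i·w ↦ w` on the complexification. -/
noncomputable def complexificationIm (V : Type*) [AddCommGroup V] [Module ℝ V] :
    (ℂ ⊗[ℝ] V) →ₗ[ℝ] V :=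
  (TensorProduct.lid ℝ V).toLinearMap ∘ₗ LinearMap.rTensor V Complex.imLm

section Complexification

variable {V : Type*} [AddCommGroup V] [Module ℝ V]

@[simp]
theorem complexificationRe_tmul (z : ℂ) (v : V) :
    complexificationRe V (z ⊗ₜ v) = z.re • v := by
  simp [complexificationRe]

@[simp]
theorem complexificationIm_tmul (z : ℂ) (v : V) :
    complexificationIm V (z ⊗ₜ v) = z.im • v := by
  simp [complexificationIm]

@[simp]
theorem complexificationConj_tmul (z : ℂ) (v : V) :
    complexificationConj V (z ⊗ₜ v) = (starRingEnd ℂ z) ⊗ₜ v := by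
  simp [complexificationConj]

theorem one_tmul_re_add_I_tmul_im (x : ℂ ⊗[ℝ] V) :
    (1 : ℂ) ⊗ₜ[ℝ] complexificationRe V x + Complex.I ⊗ₜ[ℝ] complexificationIm V x = x := by
  induction x with
  | zero => simp
  | tmul z v =>
    rw [complexificationRe_tmul, complexificationIm_tmul, ← TensorProduct.smul_tmul,
      ← TensorProduct.smul_tmul, ← TensorProduct.add_tmul]
    congr 1
    apply Complex.ext <;> simp
  | add x y hx hy =>
    conv_rhs => rw [← hx, ← hy]
    simp only [map_add, TensorProduct.tmul_add]
    abel

theorem complexificationConj_eq_neg_of_re_eq_zero {x : ℂ ⊗[ℝ] V}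
    (hx : complexificationRe V x = 0) : complexificationConj V x = -x := by
  rw [← one_tmul_re_add_I_tmul_im x, hx]
  simp [TensorProduct.neg_tmul]

theorem injOn_complexificationRe_of_inter_conj {E : Submodule ℂ (ℂ ⊗[ℝ] V)}
    (hE : (E : Set (ℂ ⊗[ℝ] V)) ∩ (complexificationConj V '' (E : Set (ℂ ⊗[ℝ] V))) = {0}) :
    Function.Injective (complexificationRe V ∘ₗ (E.restrictScalars ℝ).subtype) := by
  rw [injective_iff_map_eq_zero]
  rintro ⟨x, hx⟩ (h : complexificationRe V x = 0)
  have hmem : x ∈ (E : Set (ℂ ⊗[ℝ] V)) ∩ (complexificationConj V '' (E : Set (ℂ ⊗[ℝ] V))) :=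
    ⟨hx, -x, E.neg_mem hx, by
      rw [map_neg, complexificationConj_eq_neg_of_re_eq_zero h, neg_neg]⟩
  rw [hE] at hmem
  exact Subtype.ext hmem

end Complexification

/-- Let `V` be a real vector space of dimension `2 n` and let `E` be a complex
subspace of the complexification `V_ℂ = ℂ ⊗[ℝ] V` with `dim_ℂ E = n` and `E ∩ Ē = {0}`.
Then there exists a unique `ℝ`-linear map `K : V → V` such that `K ∘ K = -id` and
`E = {v + i·K v : v ∈ V}`. -/
theorem exists_unique_complex_structure_of_transverse_subspace
    {V : Type*} [AddCommGroup V] [Module ℝ V] [FiniteDimensional ℝ V] (n : ℕ)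
    (hdim : Module.finrank ℝ V = 2 * n)
    (E : Submodule ℂ (ℂ ⊗[ℝ] V))
    (hEdim : Module.finrank ℂ E = n)
    (hEconj : (E : Set (ℂ ⊗[ℝ] V)) ∩ (complexificationConj V '' (E : Set (ℂ ⊗[ℝ] V))) = {0}) :
    ∃! K : V →ₗ[ℝ] V, (∀ v : V, K (K v) = -v) ∧
      (E : Set (ℂ ⊗[ℝ] V)) =
        {x | ∃ v : V, x = (1 : ℂ) ⊗ₜ[ℝ] v + Complex.I ⊗ₜ[ℝ] (K v)} := by
  have hfin : Module.finrank ℝ (E.restrictScalars ℝ) = Module.finrank ℝ V := by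
    rw [hdim, ← hEdim]
    exact finrank_real_of_complex E
  let e : (E.restrictScalars ℝ) ≃ₗ[ℝ] V :=
    LinearEquiv.ofInjectiveOfFinrankEq _ (injOn_complexificationRe_of_inter_conj hEconj) hfin
  have he (x : E.restrictScalars ℝ) : e x = complexificationRe V x := rfl
  let K : V →ₗ[ℝ] V := complexificationIm V ∘ₗ (E.restrictScalars ℝ).subtype ∘ₗ e.symm
  have hK {x : ℂ ⊗[ℝ] V} (hx : x ∈ E) : K (complexificationRe V x) = complexificationIm V x := by
    change complexificationIm V (e.symm (e ⟨x, hx⟩)) = _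
    rw [e.symm_apply_apply]
  have hmem (v : V) : (1 : ℂ) ⊗ₜ[ℝ] v + Complex.I ⊗ₜ[ℝ] (K v) ∈ E := by
    have h := one_tmul_re_add_I_tmul_im (e.symm v : ℂ ⊗[ℝ] V)
    rw [← he, e.apply_symm_apply] at h
    change _ + Complex.I ⊗ₜ[ℝ] complexificationIm V (e.symm v) ∈ E
    rw [h]
    exact (e.symm v).2
  refine ⟨K, ⟨fun v ↦ ?_, ?_⟩, fun K' hK' ↦ ?_⟩
  · have h := hK (E.smul_mem Complex.I (hmem v))
    simp only [smul_add, TensorProduct.smul_tmul', smul_eq_mul, mul_one, Complex.I_mul_I,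
      map_add, complexificationRe_tmul, complexificationIm_tmul] at h
    simp only [Complex.I_re, Complex.I_im, Complex.neg_re, Complex.neg_im, Complex.one_re,
      Complex.one_im, zero_smul, one_smul, neg_smul, neg_zero, zero_add, add_zero, map_neg,
      map_zero] at h
    exact neg_eq_iff_eq_neg.mp h
  · ext x
    refine ⟨fun hx ↦ ⟨complexificationRe V x, ?_⟩, ?_⟩
    · rw [hK hx, one_tmul_re_add_I_tmul_im]
    · rintro ⟨v, rfl⟩
      exact hmem v
  · ext v
    have hv : (1 : ℂ) ⊗ₜ[ℝ] v + Complex.I ⊗ₜ[ℝ] (K' v) ∈ (E : Set (ℂ ⊗[ℝ] V)) := by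
      rw [hK'.2]
      exact ⟨v, rfl⟩
    simpa using (hK hv).symm
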